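/- Let n ≥ 1 be a natural number, let a, τ ∈ ℝ with a < 0 and τ > 2, set Δ = 2 − τ and μ = a/Δ, and let W be an n×n complex matrix such that, with V = Wᴴ, the relations W·W·V = a•W − V·W·W + τ•(W·V·W) and W·V·V = a•V − V·V·W + τ•(V·W·V) hold. Set D = W·Wᴴ and D̃ = Wᴴ·W, and assume there is ĉ₁ ∈ ℝ with (−4a)•(D + D̃) + (2 − τ)•(D + D̃)² + (2 + τ)•(D − D̃)² = (4ĉ₁)•I, and set ĉ = μ² + ĉ₁/Δ. Assume the representation is irreducible: every subspace U of ℂⁿ with W·U ⊆ U and Wᴴ·U ⊆ U satisfies U = {0} or U = ℂⁿ. If ĉ ≤ 0, or if ĉ > 0 and μ ≤ √ĉ, then n = 1. -/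

import Mathlib

open scoped Matrix

/-- An eigenvalue of `A * Aᴴ` is a nonnegative real number. -/
lemma exists_nonneg_eq_of_mul_conjTranspose_mulVec {n : ℕ} {A : Matrix (Fin n) (Fin n) ℂ}
    {x : Fin n → ℂ} {z : ℂ} (hx : x ≠ 0) (h : (A * Aᴴ) *ᵥ x = z • x) :
    ∃ r : ℝ, 0 ≤ r ∧ (A * Aᴴ) *ᵥ x = r • x := by
  open scoped ComplexOrder in
  have key : z * (star x ⬝ᵥ x) = star (Aᴴ *ᵥ x) ⬝ᵥ (Aᴴ *ᵥ x) := by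
    rw [← smul_eq_mul, ← dotProduct_smul, ← h, Matrix.star_mulVec,
      Matrix.conjTranspose_conjTranspose, ← Matrix.mulVec_mulVec, Matrix.dotProduct_mulVec]
  have h0 : 0 < star x ⬝ᵥ x := Matrix.dotProduct_star_self_pos_iff.2 hx
  have h1 : 0 ≤ star (Aᴴ *ᵥ x) ⬝ᵥ (Aᴴ *ᵥ x) := dotProduct_star_self_nonneg _
  have hz : 0 ≤ z := by
    rw [← key] at h1
    simpa [h0.ne'] using mul_nonneg h1 (inv_nonneg.2 h0.le)
  obtain ⟨hre, him⟩ := Complex.nonneg_iff.1 hz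
  refine ⟨z.re, hre, ?_⟩
  have hzr : z = (z.re : ℂ) := Complex.ext rfl (by simp [← him])
  rw [h]
  ext i
  rw [hzr]
  simp

/-- `x` is a nonzero vector with `W Wᴴ x = p x` and `Wᴴ W x = q x`. -/
def IsJointEigenvector {n : ℕ} (W : Matrix (Fin n) (Fin n) ℂ) (p q : ℝ) (x : Fin n → ℂ) : Prop :=
  x ≠ 0 ∧ (W * Wᴴ) *ᵥ x = p • x ∧ (Wᴴ * W) *ᵥ x = q • x

lemma exists_mulVec_eq_smul {n : ℕ} [NeZero n] (A : Matrix (Fin n) (Fin n) ℂ) :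
    ∃ (z : ℂ) (x : Fin n → ℂ), x ≠ 0 ∧ A *ᵥ x = z • x := by
  obtain ⟨z, hz⟩ := Module.End.exists_eigenvalue (Matrix.toLin' A)
  obtain ⟨x, hx⟩ := hz.exists_hasEigenvector
  exact ⟨z, x, hx.2, by simpa using hx.apply_eq_smul⟩

lemma exists_common_eigenvector {n : ℕ} [NeZero n] {A B : Matrix (Fin n) (Fin n) ℂ}
    (hAB : Commute A B) :
    ∃ (z w : ℂ) (x : Fin n → ℂ), x ≠ 0 ∧ A *ᵥ x = z • x ∧ B *ᵥ x = w • x := by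
  obtain ⟨z, hz⟩ := Module.End.exists_eigenvalue (Matrix.toLin' A)
  have hcomm : Commute (Matrix.toLin' A) (Matrix.toLin' B) := by
    rw [Commute, SemiconjBy, Module.End.mul_eq_comp, Module.End.mul_eq_comp,
      ← Matrix.toLin'_mul, ← Matrix.toLin'_mul, hAB.eq]
  have hmaps := Module.End.mapsTo_genEigenspace_of_comm hcomm z 1
  have : Nontrivial (Module.End.eigenspace (Matrix.toLin' A) z) :=
    Submodule.nontrivial_iff_ne_bot.2 hz
  obtain ⟨w, hw⟩ := Module.End.exists_eigenvalue ((Matrix.toLin' B).restrict hmaps)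
  obtain ⟨x, hx⟩ := hw.exists_hasEigenvector
  refine ⟨z, w, x, fun h => hx.2 (Subtype.ext h), ?_, ?_⟩
  · simpa using Module.End.mem_eigenspace_iff.1 x.2
  · exact congrArg Subtype.val hx.apply_eq_smul

lemma exists_isJointEigenvector {n : ℕ} [NeZero n] {W : Matrix (Fin n) (Fin n) ℂ}
    (hW : Commute (W * Wᴴ) (Wᴴ * W)) : ∃ p q x, IsJointEigenvector W p q x := by
  obtain ⟨z, w, x, hx, hz, hw⟩ := exists_common_eigenvector hW
  obtain ⟨p, -, hp⟩ := exists_nonneg_eq_of_mul_conjTranspose_mulVec hx hz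
  obtain ⟨q, -, hq⟩ := exists_nonneg_eq_of_mul_conjTranspose_mulVec (A := Wᴴ) hx
    (by simpa using hw)
  exact ⟨p, q, x, hx, hp, by simpa using hq⟩

namespace IsJointEigenvector

variable {n : ℕ} {W : Matrix (Fin n) (Fin n) ℂ} {p q : ℝ} {x : Fin n → ℂ}

lemma left_nonneg (h : IsJointEigenvector W p q x) : 0 ≤ p := by
  obtain ⟨r, hr, hrx⟩ := exists_nonneg_eq_of_mul_conjTranspose_mulVec (z := (p : ℂ)) h.1
    (by rw [h.2.1]; ext i; simp)
  rwa [← smul_left_injective ℝ h.1 (hrx.symm.trans h.2.1)]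

lemma conjTranspose (h : IsJointEigenvector W p q x) : IsJointEigenvector Wᴴ q p x :=
  ⟨h.1, by simpa using h.2.2, by simpa using h.2.1⟩

lemma right_nonneg (h : IsJointEigenvector W p q x) : 0 ≤ q :=
  h.conjTranspose.left_nonneg

lemma mulVec_ne_zero (h : IsJointEigenvector W p q x) (hq : q ≠ 0) : W *ᵥ x ≠ 0 := by
  intro h0
  have := h.2.2
  rw [← Matrix.mulVec_mulVec, h0, Matrix.mulVec_zero] at this
  exact smul_ne_zero hq h.1 this.symm

lemma mulVec_eq_zero (h : IsJointEigenvector W p 0 x) : W *ᵥ x = 0 := by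
  have := h.2.2
  open scoped ComplexOrder in
  rwa [zero_smul, Matrix.conjTranspose_mul_self_mulVec_eq_zero] at this

lemma mulVec_left {a τ : ℝ} (h1 : W * W * Wᴴ = a • W - Wᴴ * W * W + τ • (W * Wᴴ * W))
    (h : IsJointEigenvector W p q x) (hq : q ≠ 0) :
    IsJointEigenvector W q (a - p + τ * q) (W *ᵥ x) := by
  have hD : (W * Wᴴ) *ᵥ (W *ᵥ x) = q • (W *ᵥ x) := by
    rw [Matrix.mulVec_mulVec, Matrix.mul_assoc, ← Matrix.mulVec_mulVec, h.2.2,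
      Matrix.mulVec_smul]
  refine ⟨h.mulVec_ne_zero hq, hD, ?_⟩
  have e := congrArg (· *ᵥ x) h1
  simp only [Matrix.add_mulVec, Matrix.sub_mulVec, Matrix.smul_mulVec] at e
  rw [Matrix.mul_assoc W W, ← Matrix.mulVec_mulVec, h.2.1, Matrix.mulVec_smul,
    ← Matrix.mulVec_mulVec x (Wᴴ * W) W, ← Matrix.mulVec_mulVec x (W * Wᴴ) W, hD] at e
  linear_combination (norm := module) e

end IsJointEigenvector

/-- In an irreducible representation, a common eigenvector of `W` and `Wᴴ` forces dimension one. -/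
lemma eq_one_of_common_eigenvector {n : ℕ} {W : Matrix (Fin n) (Fin n) ℂ}
    (hirr : ∀ U : Submodule ℂ (Fin n → ℂ),
      (∀ x ∈ U, W.mulVec x ∈ U) → (∀ x ∈ U, Wᴴ.mulVec x ∈ U) → U = ⊥ ∨ U = ⊤)
    {x : Fin n → ℂ} (hx : x ≠ 0) {z w : ℂ} (hz : W *ᵥ x = z • x) (hw : Wᴴ *ᵥ x = w • x) :
    n = 1 := by
  have hU := hirr (Submodule.span ℂ {x}) ?_ ?_
  · rcases hU with hU | hU
    · exact absurd (Submodule.span_singleton_eq_bot.1 hU) hx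
    · have := finrank_span_singleton (K := ℂ) hx
      rw [hU, finrank_top] at this
      simpa using this
  all_goals
    intro y hy
    obtain ⟨k, rfl⟩ := Submodule.mem_span_singleton.1 hy
    rw [Matrix.mulVec_smul]
    refine Submodule.smul_mem _ _ ?_
    simp only [hz, hw]
    exact Submodule.smul_mem _ _ (Submodule.mem_span_singleton_self x)

/-- If some joint eigenvector of `W Wᴴ` and `Wᴴ W` has both eigenvalues equal to a fixed point
`μ` of the eigenvalue recursion, then an irreducible representation has dimension one. -/
lemma eq_one_of_isJointEigenvector_fixed {n : ℕ} [NeZero n] {W : Matrix (Fin n) (Fin n) ℂ}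
    {a τ μ : ℝ} (hμ : μ ≠ 0) (hfix : a - μ + τ * μ = μ)
    (h1 : W * W * Wᴴ = a • W - Wᴴ * W * W + τ • (W * Wᴴ * W))
    (h2 : Wᴴ * Wᴴ * W = a • Wᴴ - W * Wᴴ * Wᴴ + τ • (Wᴴ * W * Wᴴ))
    (hirr : ∀ U : Submodule ℂ (Fin n → ℂ),
      (∀ x ∈ U, W.mulVec x ∈ U) → (∀ x ∈ U, Wᴴ.mulVec x ∈ U) → U = ⊥ ∨ U = ⊤)
    {x : Fin n → ℂ} (hx : IsJointEigenvector W μ μ x) : n = 1 := by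
  let U : Submodule ℂ (Fin n → ℂ) :=
    Module.End.eigenspace (Matrix.toLin' (W * Wᴴ)) μ ⊓
      Module.End.eigenspace (Matrix.toLin' (Wᴴ * W)) μ
  have memU (y : Fin n → ℂ) :
      y ∈ U ↔ (W * Wᴴ) *ᵥ y = μ • y ∧ (Wᴴ * W) *ᵥ y = μ • y := by
    simp [U, Submodule.mem_inf]
  have hU := hirr U ?_ ?_
  · rcases hU with hU | hU
    · have hxU := (memU x).2 hx.2
      rw [hU, Submodule.mem_bot] at hxU
      exact absurd hxU hx.1
    · obtain ⟨z, y, hy, hz⟩ := exists_mulVec_eq_smul W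
      have hyU := ((memU y).1 (hU ▸ Submodule.mem_top)).2
      rw [← Matrix.mulVec_mulVec, hz, Matrix.mulVec_smul] at hyU
      have hz0 : z ≠ 0 := by
        rintro rfl
        rw [zero_smul] at hyU
        exact smul_ne_zero hμ hy hyU.symm
      refine eq_one_of_common_eigenvector hirr hy hz (w := z⁻¹ * μ) ?_
      rw [mul_smul, eq_inv_smul_iff₀ hz0, hyU]
      ext i
      simp
  · intro y hy
    by_cases hy0 : y = 0
    · simp [hy0]
    have hj : IsJointEigenvector W μ μ y := ⟨hy0, (memU y).1 hy⟩
    have := (hj.mulVec_left h1 hμ).2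
    rw [hfix] at this
    exact (memU _).2 this
  · intro y hy
    by_cases hy0 : y = 0
    · simp [hy0]
    have hj : IsJointEigenvector W μ μ y := ⟨hy0, (memU y).1 hy⟩
    have := (hj.conjTranspose.mulVec_left (by simpa using h2) hμ).conjTranspose.2
    rw [hfix, Matrix.conjTranspose_conjTranspose] at this
    exact (memU _).2 this

/-- A joint eigenvector whose `W Wᴴ`-eigenvalue is the largest one occurring. -/
lemma exists_isJointEigenvector_max {n : ℕ} [NeZero n] {W : Matrix (Fin n) (Fin n) ℂ}
    (hW : Commute (W * Wᴴ) (Wᴴ * W)) :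
    ∃ p q x, IsJointEigenvector W p q x ∧ ∀ p' q' y, IsJointEigenvector W p' q' y → p' ≤ p := by
  let S : Set ℝ := {p | ∃ q x, IsJointEigenvector W p q x}
  have hfin : S.Finite := by
    refine Set.Finite.of_finite_image (f := ((↑) : ℝ → ℂ)) ?_ Complex.ofReal_injective.injOn
    refine (Module.End.finite_hasEigenvalue (Matrix.toLin' (W * Wᴴ))).subset ?_
    rintro _ ⟨p, ⟨q, x, hx⟩, rfl⟩
    refine Module.End.hasEigenvalue_of_hasEigenvector (x := x)
      ⟨Module.End.mem_eigenspace_iff.2 ?_, hx.1⟩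
    simpa using hx.2.1
  obtain ⟨p₀, q₀, x₀, h₀⟩ := exists_isJointEigenvector hW
  obtain ⟨p, ⟨q, x, hx⟩, hmax⟩ := S.exists_max_image id hfin ⟨p₀, q₀, x₀, h₀⟩
  exact ⟨p, q, x, hx, fun p' q' y hy => hmax p' ⟨q', y, hy⟩⟩

/-- an irreducible finite-dimensional ∗-representation of `C_{L,a}` with
`det A = 1`, `a < 0`, `tr A = τ > 2` (so `Δ = 2 − τ < 0`), Casimir value `4ĉ₁`, and
`ĉ = μ² + ĉ₁/Δ` satisfying `ĉ ≤ 0`, or `ĉ > 0` and `μ ≤ √ĉ`, is one-dimensional. -/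
theorem stmt_12 (n : ℕ) (hn : 1 ≤ n) (a τ : ℝ) (ha : a < 0) (hτ : 2 < τ)
    (Δ μ : ℝ) (hΔ : Δ = 2 - τ) (hμ : μ = a / Δ)
    (W : Matrix (Fin n) (Fin n) ℂ)
    (h1 : W * W * Wᴴ = a • W - Wᴴ * W * W + τ • (W * Wᴴ * W))
    (h2 : W * Wᴴ * Wᴴ = a • Wᴴ - Wᴴ * Wᴴ * W + τ • (Wᴴ * W * Wᴴ))
    (D D' : Matrix (Fin n) (Fin n) ℂ) (hD : D = W * Wᴴ) (hD' : D' = Wᴴ * W)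
    (c₁ c : ℝ)
    (hCas : (-4 * a) • (D + D') + (2 - τ) • (D + D') ^ 2 + (2 + τ) • (D - D') ^ 2
      = (4 * c₁) • (1 : Matrix (Fin n) (Fin n) ℂ))
    (hc : c = μ ^ 2 + c₁ / Δ)
    (hirr : ∀ U : Submodule ℂ (Fin n → ℂ),
      (∀ x ∈ U, W.mulVec x ∈ U) → (∀ x ∈ U, Wᴴ.mulVec x ∈ U) →
      U = ⊥ ∨ U = ⊤)
    (hcase : c ≤ 0 ∨ (0 < c ∧ μ ≤ Real.sqrt c)) :
    n = 1 := by
  have : NeZero n := ⟨by omega⟩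
  subst hD hD'
  have h2' : Wᴴ * Wᴴ * W = a • Wᴴ - W * Wᴴ * Wᴴ + τ • (Wᴴ * W * Wᴴ) := by
    rw [h2]; abel
  have hcomm : Commute (W * Wᴴ) (Wᴴ * W) := by
    have e1 := congrArg (· * Wᴴ) h1
    have e2 := congrArg (W * ·) h2
    simp only [add_mul, sub_mul, mul_add, mul_sub, smul_mul_assoc, mul_smul_comm,
      Matrix.mul_assoc] at e1 e2
    rw [Commute, SemiconjBy]
    simp only [Matrix.mul_assoc]
    linear_combination (norm := module) e2 - e1
  obtain ⟨p, q, x, hx, hmax⟩ := exists_isJointEigenvector_max hcomm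
  have hp := hx.left_nonneg
  have hq := hx.right_nonneg
  have hΔ0 : Δ < 0 := by linarith
  have haμ : a = μ * Δ := by rw [hμ, div_mul_cancel₀ _ hΔ0.ne]
  have hμ0 : 0 < μ := hμ ▸ div_pos_of_neg_of_neg ha hΔ0
  have hqp : q ≤ p := by
    by_cases hq0 : q = 0
    · exact hq0 ▸ hp
    · exact hmax _ _ _ (hx.mulVec_left h1 hq0)
  by_cases hp0 : p = 0
  · obtain rfl : q = 0 := by linarith
    subst hp0
    exact eq_one_of_common_eigenvector hirr hx.1 (z := 0) (w := 0)
      (by rw [hx.mulVec_eq_zero, zero_smul])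
      (by rw [hx.conjTranspose.mulVec_eq_zero, zero_smul])
  have hle : a - q + τ * p ≤ p :=
    hmax _ _ _ (by
      simpa using (hx.conjTranspose.mulVec_left (by simpa using h2') hp0).conjTranspose)
  have hc₁ : -4 * a * (p + q) + (2 - τ) * (p + q) ^ 2 + (2 + τ) * (p - q) ^ 2 = 4 * c₁ := by
    refine smul_left_injective ℝ hx.1 ?_
    have e := congrArg (· *ᵥ x) hCas
    simp only [Matrix.add_mulVec, Matrix.sub_mulVec, Matrix.smul_mulVec, pow_two,
      ← Matrix.mulVec_mulVec x (_ + _), ← Matrix.mulVec_mulVec x (_ - _), hx.2.1, hx.2.2,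
      Matrix.mulVec_add, Matrix.mulVec_sub, Matrix.mulVec_smul, Matrix.one_mulVec] at e
    simp only
    linear_combination (norm := module) e
  -- The Casimir value in terms of the distances of `p` and `q` from the fixed point.
  obtain ⟨α, rfl⟩ : ∃ α, p = μ - α := ⟨μ - p, by ring⟩
  obtain ⟨β, rfl⟩ : ∃ β, q = μ - β := ⟨μ - q, by ring⟩
  have hcΔ : (β - α) ^ 2 + Δ * (α * β) = Δ * c := by
    have : Δ * c = Δ * μ ^ 2 + c₁ := by rw [hc, mul_add, mul_div_cancel₀ _ hΔ0.ne]
    rw [this]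
    obtain rfl : τ = 2 - Δ := by linarith
    subst haμ
    linear_combination hc₁ / 4
  obtain rfl : τ = 2 - Δ := by linarith
  have hβ1 : α ≤ β := by linarith
  have hβ2 : β - α ≤ -Δ * α := by rw [haμ] at hle; linarith
  have hα0 : 0 ≤ α := by
    by_contra! h
    nlinarith
  have hαμ : α < μ := lt_of_le_of_ne (by linarith) fun h => hp0 (by linarith)
  rcases hcase with hc0 | ⟨hc0, hc1⟩
  · have hα : α = 0 := by
      have h3 : 0 ≤ Δ * c := mul_nonneg_of_nonpos_of_nonpos hΔ0.le hc0
      have h4 : (β - α) * (β - α) ≤ (β - α) * (-Δ * α) :=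
        mul_le_mul_of_nonneg_left hβ2 (by linarith)
      have h5 : 0 ≤ Δ * α ^ 2 := by nlinarith
      by_contra h
      have : 0 < α ^ 2 := by positivity
      nlinarith
    subst hα
    obtain rfl : β = 0 := by linarith
    simp only [sub_zero] at hx
    exact eq_one_of_isJointEigenvector_fixed hμ0.ne' (by rw [haμ]; ring) h1 h2' hirr hx
  · have h3 : μ ^ 2 ≤ c := (Real.le_sqrt hμ0.le hc0.le).1 hc1
    have h4 : α * β < μ ^ 2 := by nlinarith
    nlinarith [sq_nonneg (β - α)]
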